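/- Let A ∈ ℝ^{2n×2n} be symmetric positive definite with symplectic eigenvalues 0 < d₁ ≤ … ≤ d_n, let 1 ≤ p ≤ n, and let β > d_p. Then the function f_β on ℝ^{2n×2p} has no local minimizers other than its global minimizers; that is, every local minimizer of f_β is a global minimizer of f_β. -/

import Mathlib

open Matrix BigOperators

noncomputable section

/-- The Poisson matrix `J_k = [[0, I],[-I, 0]]`, on index type `Fin k ⊕ Fin k`
(representing dimension `2k`). -/
def Jmat (k : ℕ) : Matrix (Fin k ⊕ Fin k) (Fin k ⊕ Fin k) ℝ :=
  Matrix.fromBlocks 0 1 (-1) 0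

/-- Squared Frobenius norm `‖M‖_F² = tr(Mᵀ M)`. -/
def frobSq {m k : Type*} [Fintype m] [Fintype k] (M : Matrix m k ℝ) : ℝ :=
  Matrix.trace (Mᵀ * M)

/-- The Frobenius norm. -/
def frobNorm {m k : Type*} [Fintype m] [Fintype k] (M : Matrix m k ℝ) : ℝ :=
  Real.sqrt (frobSq M)

/-- The trace-penalty function `f_β`. -/
def fPen (n p : ℕ) (A : Matrix (Fin n ⊕ Fin n) (Fin n ⊕ Fin n) ℝ) (β : ℝ)
    (X : Matrix (Fin n ⊕ Fin n) (Fin p ⊕ Fin p) ℝ) : ℝ :=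
  (1 / 2) * Matrix.trace (Xᵀ * A * X) + (β / 4) * frobSq (Xᵀ * Jmat n * X - Jmat p)

/-- The gradient `∇f_β(X) = AX - βJ_nX(XᵀJ_nX - J_p)`. -/
def gradPen (n p : ℕ) (A : Matrix (Fin n ⊕ Fin n) (Fin n ⊕ Fin n) ℝ) (β : ℝ)
    (X : Matrix (Fin n ⊕ Fin n) (Fin p ⊕ Fin p) ℝ) :
    Matrix (Fin n ⊕ Fin n) (Fin p ⊕ Fin p) ℝ :=
  A * X - β • (Jmat n * X * (Xᵀ * Jmat n * X - Jmat p))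

lemma quartic_coeffs_of_isLocalMin {a₀ a b c e : ℝ}
    (h : IsLocalMin (fun t : ℝ => a₀ + a * t + b * t ^ 2 + c * t ^ 3 + e * t ^ 4) 0) :
    a = 0 ∧ 0 ≤ b := by
  have hd : HasDerivAt (fun t : ℝ => a₀ + a * t + b * t ^ 2 + c * t ^ 3 + e * t ^ 4) a 0 := by
    have h1 := (((((hasDerivAt_id (0 : ℝ)).const_mul a).const_add a₀).add
      (((hasDerivAt_id (0 : ℝ)).pow 2).const_mul b)).add
      (((hasDerivAt_id (0 : ℝ)).pow 3).const_mul c)).add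
      (((hasDerivAt_id (0 : ℝ)).pow 4).const_mul e)
    exact h1.congr_deriv (by simp)
  have ha : a = 0 := h.hasDerivAt_eq_zero hd
  refine ⟨ha, ?_⟩
  have hlim : Filter.Tendsto (fun t : ℝ => b + c * t + e * t ^ 2) (nhdsWithin 0 {0}ᶜ) (nhds b) := by
    have hc : Continuous (fun t : ℝ => b + c * t + e * t ^ 2) := by fun_prop
    have := hc.tendsto 0
    simp only [mul_zero, ne_eq, OfNat.ofNat_ne_zero, not_false_eq_true, zero_pow, add_zero] at this
    exact this.mono_left nhdsWithin_le_nhds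
  refine ge_of_tendsto hlim ?_
  filter_upwards [h.filter_mono nhdsWithin_le_nhds, self_mem_nhdsWithin] with t ht ht0
  have ht2 : 0 < t ^ 2 := by
    have : t ≠ 0 := ht0
    positivity
  subst ha
  have : 0 ≤ t ^ 2 * (b + c * t + e * t ^ 2) := by
    simp only [ne_eq, OfNat.ofNat_ne_zero, not_false_eq_true, zero_pow] at ht
    nlinarith [ht]
  exact nonneg_of_mul_nonneg_right this ht2

lemma Jmat_transpose (k : ℕ) : (Jmat k)ᵀ = -Jmat k := by
  simp [Jmat, fromBlocks_transpose, fromBlocks_neg]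

lemma Jmat_mul_self (k : ℕ) : Jmat k * Jmat k = -1 := by
  simp [Jmat, fromBlocks_multiply, ← fromBlocks_one, fromBlocks_neg]

lemma Jmat_mul_diagonal {k : ℕ} (d : Fin k → ℝ) :
    Jmat k * diagonal (Sum.elim d d) = diagonal (Sum.elim d d) * Jmat k := by
  rw [← fromBlocks_diagonal]
  simp [Jmat, fromBlocks_multiply, -fromBlocks_diagonal]

lemma trace_transpose_mul_diagonal_mul {m k : Type*} [Fintype m] [Fintype k] [DecidableEq m]
    (δ : m → ℝ) (E : Matrix m k ℝ) :
    trace (Eᵀ * diagonal δ * E) = ∑ j, ∑ i, δ i * E i j ^ 2 := by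
  simp only [trace, diag_apply, mul_apply (M := _ * _), mul_diagonal, transpose_apply]
  refine Finset.sum_congr rfl fun j _ => Finset.sum_congr rfl fun i _ => ?_
  ring

lemma frobSq_eq_sum {m k : Type*} [Fintype m] [Fintype k] (E : Matrix m k ℝ) :
    frobSq E = ∑ j, ∑ i, E i j ^ 2 := by
  simp only [frobSq, trace, diag_apply, mul_apply, transpose_apply, sq]

lemma frobSq_nonneg {m k : Type*} [Fintype m] [Fintype k] (E : Matrix m k ℝ) : 0 ≤ frobSq E := by
  rw [frobSq_eq_sum]
  positivity

lemma eq_zero_of_frobSq_eq_zero {m k : Type*} [Fintype m] [Fintype k] {E : Matrix m k ℝ}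
    (h : frobSq E = 0) : E = 0 := by
  rwa [frobSq, ← conjTranspose_eq_transpose_of_trivial,
    trace_conjTranspose_mul_self_eq_zero_iff] at h

section Variation

variable {n p : ℕ}

/-- The constraint residual `XᵀJ_nX - J_p`. -/
def sympResidual (Z : Matrix (Fin n ⊕ Fin n) (Fin p ⊕ Fin p) ℝ) :
    Matrix (Fin p ⊕ Fin p) (Fin p ⊕ Fin p) ℝ :=
  Zᵀ * Jmat n * Z - Jmat p

lemma sympResidual_transpose (Z : Matrix (Fin n ⊕ Fin n) (Fin p ⊕ Fin p) ℝ) :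
    (sympResidual Z)ᵀ = -sympResidual Z := by
  simp [sympResidual, Jmat_transpose, Matrix.mul_assoc]
  abel

/-- The linear part of the variation of the residual. -/
def sympResidualLin (Z U : Matrix (Fin n ⊕ Fin n) (Fin p ⊕ Fin p) ℝ) :
    Matrix (Fin p ⊕ Fin p) (Fin p ⊕ Fin p) ℝ :=
  Uᵀ * Jmat n * Z + Zᵀ * Jmat n * U

lemma sympResidual_add_smul (Z U : Matrix (Fin n ⊕ Fin n) (Fin p ⊕ Fin p) ℝ) (t : ℝ) :
    sympResidual (Z + t • U) = sympResidual Z + t • sympResidualLin Z U + t ^ 2 • (Uᵀ * Jmat n * U) := by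
  simp only [sympResidual, sympResidualLin, transpose_add, transpose_smul, Matrix.add_mul, Matrix.mul_add,
    smul_mul, Matrix.mul_smul, smul_add, smul_smul, sq]
  abel

lemma frobSq_add_smul {m k : Type*} [Fintype m] [Fintype k] (W L N : Matrix m k ℝ) (t : ℝ) :
    frobSq (W + t • L + t ^ 2 • N) = frobSq W + 2 * trace (Wᵀ * L) * t +
      (frobSq L + 2 * trace (Wᵀ * N)) * t ^ 2 + 2 * trace (Lᵀ * N) * t ^ 3 +
      frobSq N * t ^ 4 := by
  have h1 : trace (Lᵀ * W) = trace (Wᵀ * L) := by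
    rw [← trace_transpose]; simp
  have h2 : trace (Nᵀ * W) = trace (Wᵀ * N) := by
    rw [← trace_transpose]; simp
  have h3 : trace (Nᵀ * L) = trace (Lᵀ * N) := by
    rw [← trace_transpose]; simp
  simp only [frobSq, transpose_add, transpose_smul, Matrix.add_mul, Matrix.mul_add,
    smul_mul, Matrix.mul_smul, trace_add, trace_smul, smul_eq_mul, h1, h2, h3]
  ring

lemma trace_quadratic_add_smul {m k : Type*} [Fintype m] [Fintype k] {D : Matrix m m ℝ}
    (hD : Dᵀ = D) (Z U : Matrix m k ℝ) (t : ℝ) :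
    trace ((Z + t • U)ᵀ * D * (Z + t • U)) =
      trace (Zᵀ * D * Z) + 2 * trace (Uᵀ * D * Z) * t + trace (Uᵀ * D * U) * t ^ 2 := by
  have h1 : trace (Zᵀ * D * U) = trace (Uᵀ * D * Z) := by
    rw [← trace_transpose]; simp [hD, Matrix.mul_assoc]
  simp only [transpose_add, transpose_smul, Matrix.add_mul, Matrix.mul_add,
    smul_mul, Matrix.mul_smul, trace_add, trace_smul, smul_eq_mul, h1]
  ring

lemma fPen_variation {D : Matrix (Fin n ⊕ Fin n) (Fin n ⊕ Fin n) ℝ} (hD : Dᵀ = D) {β : ℝ}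
    {Z : Matrix (Fin n ⊕ Fin n) (Fin p ⊕ Fin p) ℝ} (hZ : IsLocalMin (fPen n p D β) Z)
    (U : Matrix (Fin n ⊕ Fin n) (Fin p ⊕ Fin p) ℝ) :
    trace (Uᵀ * D * Z) + β / 2 * trace ((sympResidual Z)ᵀ * sympResidualLin Z U) = 0 ∧
      0 ≤ trace (Uᵀ * D * U) / 2 + β / 4 * (frobSq (sympResidualLin Z U) +
        2 * trace ((sympResidual Z)ᵀ * (Uᵀ * Jmat n * U))) := by
  have hcont : ContinuousAt (fun t : ℝ => Z + t • U) 0 := by fun_prop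
  have hmin : IsLocalMin (fun t : ℝ => fPen n p D β (Z + t • U)) 0 := by
    have hZ' : IsLocalMin (fPen n p D β) (Z + (0 : ℝ) • U) := by simpa using hZ
    exact hZ'.comp_continuous (g := fun t : ℝ => Z + t • U) hcont
  have hexp : (fun t : ℝ => fPen n p D β (Z + t • U)) = fun t : ℝ =>
      fPen n p D β Z +
      (trace (Uᵀ * D * Z) + β / 2 * trace ((sympResidual Z)ᵀ * sympResidualLin Z U)) * t +
      (trace (Uᵀ * D * U) / 2 + β / 4 * (frobSq (sympResidualLin Z U) +
        2 * trace ((sympResidual Z)ᵀ * (Uᵀ * Jmat n * U)))) * t ^ 2 +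
      (β / 2 * trace ((sympResidualLin Z U)ᵀ * (Uᵀ * Jmat n * U))) * t ^ 3 +
      (β / 4 * frobSq (Uᵀ * Jmat n * U)) * t ^ 4 := by
    funext t
    have h1 : fPen n p D β (Z + t • U) = 1 / 2 * trace ((Z + t • U)ᵀ * D * (Z + t • U)) +
      β / 4 * frobSq (sympResidual (Z + t • U)) := rfl
    have h2 : fPen n p D β Z = 1 / 2 * trace (Zᵀ * D * Z) + β / 4 * frobSq (sympResidual Z) := rfl
    rw [h1, h2, sympResidual_add_smul, frobSq_add_smul, trace_quadratic_add_smul hD]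
    ring
  rw [hexp] at hmin
  exact quartic_coeffs_of_isLocalMin hmin

lemma gradPen_eq_zero {D : Matrix (Fin n ⊕ Fin n) (Fin n ⊕ Fin n) ℝ} (hD : Dᵀ = D) {β : ℝ}
    {Z : Matrix (Fin n ⊕ Fin n) (Fin p ⊕ Fin p) ℝ} (hZ : IsLocalMin (fPen n p D β) Z) :
    gradPen n p D β Z = 0 := by
  apply eq_zero_of_frobSq_eq_zero
  set U := gradPen n p D β Z with hU
  have h := (fPen_variation hD hZ U).1
  have h1 : trace ((sympResidual Z)ᵀ * (Uᵀ * Jmat n * Z)) =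
      -trace (Uᵀ * (Jmat n * Z * sympResidual Z)) := by
    rw [sympResidual_transpose, trace_mul_comm]
    simp [Matrix.mul_assoc]
  have h2 : trace ((sympResidual Z)ᵀ * (Zᵀ * Jmat n * U)) =
      -trace (Uᵀ * (Jmat n * Z * sympResidual Z)) := by
    rw [← trace_transpose]
    simp [Jmat_transpose, Matrix.mul_assoc]
  rw [sympResidualLin, Matrix.mul_add, trace_add, h1, h2] at h
  have h3 : U = D * Z - β • (Jmat n * Z * sympResidual Z) := rfl
  rw [frobSq]
  nth_rewrite 2 [h3]
  rw [Matrix.mul_sub, trace_sub, Matrix.mul_smul, trace_smul, smul_eq_mul, ← Matrix.mul_assoc]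
  linarith

lemma Jmat_mul_comm_of_isLocalMin {d : Fin n → ℝ} (hd : ∀ i, 0 < d i) {β : ℝ} (hβ : 0 < β)
    {Z : Matrix (Fin n ⊕ Fin n) (Fin p ⊕ Fin p) ℝ}
    (hZ : IsLocalMin (fPen n p (diagonal (Sum.elim d d)) β) Z) :
    Jmat n * Z = Z * Jmat p := by
  set D : Matrix (Fin n ⊕ Fin n) (Fin n ⊕ Fin n) ℝ := diagonal (Sum.elim d d) with hDdef
  have hδ : ∀ i, 0 < Sum.elim d d i := by rintro (i | i) <;> exact hd i
  have hnonneg : ∀ B : Matrix (Fin n ⊕ Fin n) (Fin n ⊕ Fin n) ℝ, 0 ≤ trace (Bᵀ * D * B) := by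
    intro B
    rw [hDdef, trace_transpose_mul_diagonal_mul]
    exact Finset.sum_nonneg fun j _ => Finset.sum_nonneg fun i _ =>
      mul_nonneg (hδ i).le (sq_nonneg _)
  have hDT : Dᵀ = D := diagonal_transpose _
  have hJD : Jmat n * D = D * Jmat n := Jmat_mul_diagonal d
  set W := sympResidual Z with hW
  have hWT : Wᵀ = -W := sympResidual_transpose Z
  have hgrad : D * Z = β • (Jmat n * Z * W) := sub_eq_zero.1 (gradPen_eq_zero hDT hZ)
  have hK : Zᵀ * Jmat n * Z = W + Jmat p := by rw [hW, sympResidual]; abel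
  have hKW : Zᵀ * D * Z = β • (W * W + Jmat p * W) := by
    rw [Matrix.mul_assoc, hgrad, Matrix.mul_smul, ← Matrix.add_mul, ← hK]
    simp only [Matrix.mul_assoc]
  have hJW : W * Jmat p = Jmat p * W := by
    have h1 : (Zᵀ * D * Z)ᵀ = Zᵀ * D * Z := by simp [hDT, Matrix.mul_assoc]
    rw [hKW] at h1
    simp only [transpose_smul, transpose_add, transpose_mul, hWT, Jmat_transpose] at h1
    have h2 := smul_right_injective _ hβ.ne' h1
    simpa using h2
  set E := Jmat n * Z - Z * Jmat p with hE
  have hJJ : ∀ (k l : ℕ) (B : Matrix (Fin k ⊕ Fin k) (Fin l ⊕ Fin l) ℝ),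
      Jmat k * (Jmat k * B) = -B := by
    intro k l B
    rw [← Matrix.mul_assoc, Jmat_mul_self]; simp
  have hDE : D * E = -(β • (E * (Jmat p * W))) := by
    rw [hE, Matrix.mul_sub, ← Matrix.mul_assoc, ← hJD, Matrix.mul_assoc, ← Matrix.mul_assoc D,
      hgrad]
    simp only [Matrix.mul_smul, smul_mul, Matrix.sub_mul, Matrix.mul_assoc, hJJ, hJW]
    rw [← smul_sub, ← smul_neg]
    congr 1
    simp
    abel
  have hPSD : 0 ≤ trace (E * (Jmat p * W) * Eᵀ) := by
    have h1 : Jmat p * W = Wᵀ * W + β⁻¹ • (Zᵀ * D * Z) := by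
      rw [hKW, smul_smul, inv_mul_cancel₀ hβ.ne', hWT]
      simp
    have h2 : E * (Jmat p * W) * Eᵀ =
        (W * Eᵀ)ᵀ * (W * Eᵀ) + β⁻¹ • ((Z * Eᵀ)ᵀ * D * (Z * Eᵀ)) := by
      rw [h1]
      simp only [Matrix.mul_add, Matrix.add_mul, Matrix.mul_smul, smul_mul, transpose_mul,
        transpose_transpose, Matrix.mul_assoc]
    rw [h2, trace_add, trace_smul, smul_eq_mul]
    exact add_nonneg (frobSq_nonneg _) (mul_nonneg (inv_nonneg.2 hβ.le) (hnonneg _))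
  have htr : trace (Eᵀ * D * E) ≤ 0 := by
    rw [Matrix.mul_assoc, hDE, Matrix.mul_neg, trace_neg, Matrix.mul_smul, trace_smul,
      trace_mul_comm, smul_eq_mul]
    have := mul_nonneg hβ.le hPSD
    linarith
  have hE0 : E = 0 := by
    rw [hDdef, trace_transpose_mul_diagonal_mul] at htr
    ext i j
    by_contra hne
    have hne' : E i j ≠ 0 := hne
    have hpos : 0 < Sum.elim d d i * E i j ^ 2 := mul_pos (hδ i) (by positivity)
    have hterm : ∀ i j, 0 ≤ Sum.elim d d i * E i j ^ 2 := fun i j =>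
      mul_nonneg (hδ i).le (sq_nonneg _)
    have h1 := Finset.single_le_sum (f := fun i => Sum.elim d d i * E i j ^ 2)
      (fun i _ => hterm i j) (Finset.mem_univ i)
    have h2 := Finset.single_le_sum (f := fun j => ∑ i, Sum.elim d d i * E i j ^ 2)
      (fun j _ => Finset.sum_nonneg fun i _ => hterm i j) (Finset.mem_univ j)
    linarith
  exact sub_eq_zero.1 hE0

lemma transpose_mul_Jmat_comm {Z : Matrix (Fin n ⊕ Fin n) (Fin p ⊕ Fin p) ℝ}
    (hJ : Jmat n * Z = Z * Jmat p) : Zᵀ * Jmat n = Jmat p * Zᵀ := by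
  have := congrArg transpose hJ
  simpa [Jmat_transpose] using this

lemma gram_mul_Jmat_comm {Z : Matrix (Fin n ⊕ Fin n) (Fin p ⊕ Fin p) ℝ}
    (hJ : Jmat n * Z = Z * Jmat p) : Zᵀ * Z * Jmat p = Jmat p * (Zᵀ * Z) := by
  rw [Matrix.mul_assoc, ← hJ, ← Matrix.mul_assoc, transpose_mul_Jmat_comm hJ, Matrix.mul_assoc]

lemma sympResidual_eq_gram {Z : Matrix (Fin n ⊕ Fin n) (Fin p ⊕ Fin p) ℝ}
    (hJ : Jmat n * Z = Z * Jmat p) : sympResidual Z = (Zᵀ * Z - 1) * Jmat p := by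
  rw [sympResidual, Matrix.mul_assoc, hJ, Matrix.sub_mul, Matrix.one_mul, Matrix.mul_assoc]

lemma mul_eq_of_isLocalMin {d : Fin n → ℝ} {β : ℝ}
    {Z : Matrix (Fin n ⊕ Fin n) (Fin p ⊕ Fin p) ℝ}
    (hZ : IsLocalMin (fPen n p (diagonal (Sum.elim d d)) β) Z) (hJ : Jmat n * Z = Z * Jmat p) :
    diagonal (Sum.elim d d) * Z = β • (Z * (1 - Zᵀ * Z)) := by
  have hgrad : diagonal (Sum.elim d d) * Z = β • (Jmat n * Z * sympResidual Z) :=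
    sub_eq_zero.1 (gradPen_eq_zero (diagonal_transpose _) hZ)
  have hc : (Zᵀ * Z - 1) * Jmat p = Jmat p * (Zᵀ * Z - 1) := by
    rw [Matrix.sub_mul, Matrix.mul_sub, gram_mul_Jmat_comm hJ, Matrix.one_mul, Matrix.mul_one]
  rw [hgrad, sympResidual_eq_gram hJ, hJ, hc, Matrix.mul_assoc, ← Matrix.mul_assoc (Jmat p),
    Jmat_mul_self, ← neg_sub 1 (Zᵀ * Z)]
  simp

lemma fPen_eq_of_isLocalMin {d : Fin n → ℝ} {β : ℝ}
    {Z : Matrix (Fin n ⊕ Fin n) (Fin p ⊕ Fin p) ℝ}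
    (hZ : IsLocalMin (fPen n p (diagonal (Sum.elim d d)) β) Z) (hJ : Jmat n * Z = Z * Jmat p) :
    fPen n p (diagonal (Sum.elim d d)) β Z = β / 4 * trace (1 - Zᵀ * Z * (Zᵀ * Z)) := by
  have h1 : fPen n p (diagonal (Sum.elim d d)) β Z =
      1 / 2 * trace (Zᵀ * diagonal (Sum.elim d d) * Z) + β / 4 * frobSq (sympResidual Z) := rfl
  have h2 : frobSq (sympResidual Z) = trace ((Zᵀ * Z - 1) * (Zᵀ * Z - 1)) := by
    rw [sympResidual_eq_gram hJ, frobSq, trace_mul_comm, transpose_mul, Jmat_transpose,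
      Matrix.mul_assoc, ← Matrix.mul_assoc (Jmat p), Matrix.mul_neg, Jmat_mul_self]
    simp
  rw [h1, h2, Matrix.mul_assoc, mul_eq_of_isLocalMin hZ hJ, Matrix.mul_smul, trace_smul,
    smul_eq_mul, ← Matrix.mul_assoc]
  simp only [Matrix.mul_sub, Matrix.sub_mul, trace_sub, Matrix.mul_one, Matrix.one_mul]
  ring

lemma curvature_of_isLocalMin {d : Fin n → ℝ} {β : ℝ}
    {Z : Matrix (Fin n ⊕ Fin n) (Fin p ⊕ Fin p) ℝ}
    (hZ : IsLocalMin (fPen n p (diagonal (Sum.elim d d)) β) Z) (hJ : Jmat n * Z = Z * Jmat p)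
    {v : Matrix (Fin p ⊕ Fin p) Unit ℝ} (hv : vᵀ * v = 1) {h : ℝ} (hGv : Zᵀ * Z * v = h • v)
    {u : Matrix (Fin n ⊕ Fin n) Unit ℝ} (hu : Zᵀ * u = 0) :
    0 ≤ trace (uᵀ * (diagonal (Sum.elim d d) + (β * (h - 1)) • 1) * u) := by
  set D : Matrix (Fin n ⊕ Fin n) (Fin n ⊕ Fin n) ℝ := diagonal (Sum.elim d d) with hDdef
  have hDT : Dᵀ = D := diagonal_transpose _
  have hJD : Jmat n * D = D * Jmat n := Jmat_mul_diagonal d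
  obtain ⟨G, hG⟩ : ∃ G, G = Zᵀ * Z := ⟨_, rfl⟩
  rw [← hG] at hGv
  have hGT : Gᵀ = G := by simp [hG]
  have hGJ : G * Jmat p = Jmat p * G := hG ▸ gram_mul_Jmat_comm hJ
  have hJJ : ∀ {k : ℕ} {l : Type} (B : Matrix (Fin k ⊕ Fin k) l ℝ),
      Jmat k * (Jmat k * B) = -B := by
    intro k l B
    rw [← Matrix.mul_assoc, Jmat_mul_self]; simp
  obtain ⟨B, hB⟩ : ∃ B, B = u * vᵀ := ⟨_, rfl⟩
  obtain ⟨U, hU⟩ : ∃ U, U = B - Jmat n * B * Jmat p := ⟨_, rfl⟩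
  have hUJ : U * Jmat p = Jmat n * U := by
    rw [hU, Matrix.sub_mul, Matrix.mul_sub, Matrix.mul_assoc _ (Jmat p), Jmat_mul_self,
      Matrix.mul_assoc (Jmat n) B (Jmat p), hJJ]
    simp; abel
  have hZB : Zᵀ * B = 0 := by rw [hB, ← Matrix.mul_assoc, hu, Matrix.zero_mul]
  have hZU : Zᵀ * U = 0 := by
    rw [hU, Matrix.mul_sub, hZB, Matrix.mul_assoc, ← Matrix.mul_assoc,
      transpose_mul_Jmat_comm hJ, Matrix.mul_assoc, ← Matrix.mul_assoc Zᵀ, hZB]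
    simp
  have hUZ : Uᵀ * Z = 0 := by
    have := congrArg transpose hZU
    simpa using this
  have hBG : B * G = h • B := by
    have h1 : vᵀ * G = h • vᵀ := by
      have := congrArg transpose hGv
      simpa [hGT] using this
    rw [hB, Matrix.mul_assoc, h1, Matrix.mul_smul]
  have hUG : U * G = h • U := by
    rw [hU, Matrix.sub_mul, Matrix.mul_assoc _ (Jmat p), ← hGJ, ← Matrix.mul_assoc,
      Matrix.mul_assoc (Jmat n) B G, hBG]
    simp [smul_sub]
  have hlin : sympResidualLin Z U = 0 := by
    rw [sympResidualLin, Matrix.mul_assoc, hJ, ← Matrix.mul_assoc, hUZ, Matrix.mul_assoc, ← hUJ,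
      ← Matrix.mul_assoc, hZU]
    simp
  have hquad : trace ((sympResidual Z)ᵀ * (Uᵀ * Jmat n * U)) = (h - 1) * trace (Uᵀ * U) := by
    rw [sympResidual_eq_gram hJ, ← hG, Matrix.mul_assoc Uᵀ, ← hUJ, transpose_mul, Jmat_transpose,
      trace_mul_comm, transpose_sub, hGT, transpose_one]
    have h1 : Uᵀ * (U * Jmat p) * (-Jmat p * (G - 1)) = (h - 1) • (Uᵀ * U) := by
      rw [Matrix.neg_mul, Matrix.mul_neg, Matrix.mul_assoc, Matrix.mul_assoc, hJJ, Matrix.mul_neg,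
        Matrix.mul_neg, neg_neg, Matrix.mul_sub, hUG, Matrix.mul_one, Matrix.mul_sub,
        Matrix.mul_smul, sub_smul, one_smul]
    rw [h1, trace_smul, smul_eq_mul]
  have hsecond := (fPen_variation hDT hZ U).2
  rw [hlin, hquad] at hsecond
  have hz : frobSq (0 : Matrix (Fin p ⊕ Fin p) (Fin p ⊕ Fin p) ℝ) = 0 := by simp [frobSq]
  rw [hz] at hsecond
  set T := D + (β * (h - 1)) • (1 : Matrix (Fin n ⊕ Fin n) (Fin n ⊕ Fin n) ℝ) with hT
  have hTT : Tᵀ = T := by simp [hT, hDT]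
  have hJT : Jmat n * T = T * Jmat n := by
    simp [hT, Matrix.mul_add, Matrix.add_mul, hJD]
  have hUTU : 0 ≤ trace (Uᵀ * T * U) := by
    rw [hT, Matrix.mul_add, Matrix.add_mul, trace_add, Matrix.mul_smul, smul_mul, trace_smul,
      Matrix.mul_one, smul_eq_mul]
    linarith
  have hvJv : vᵀ * Jmat p * v = 0 := by
    have h1 : (vᵀ * Jmat p * v)ᵀ = -(vᵀ * Jmat p * v) := by
      simp [Jmat_transpose, Matrix.mul_assoc]
    ext i j
    have := congrFun (congrFun h1 i) j
    simp only [transpose_apply, Matrix.neg_apply] at this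
    rw [Subsingleton.elim j i] at this ⊢
    rw [Matrix.zero_apply]
    linarith
  have hcross : trace (Bᵀ * T * (Jmat n * B * Jmat p)) = 0 := by
    have h1 : Bᵀ * T * (Jmat n * B * Jmat p) = v * (uᵀ * T * Jmat n * u * (vᵀ * Jmat p)) := by
      simp [hB, Matrix.mul_assoc]
    rw [h1, trace_mul_comm, Matrix.mul_assoc, hvJv]
    simp
  have hcross' : trace ((Jmat n * B * Jmat p)ᵀ * T * B) = 0 := by
    rw [← hcross, ← trace_transpose]
    simp [hTT, Matrix.mul_assoc]
  have hJBJ : trace ((Jmat n * B * Jmat p)ᵀ * T * (Jmat n * B * Jmat p)) =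
      trace (Bᵀ * T * B) := by
    have h1 : (Jmat n * B * Jmat p)ᵀ * T * (Jmat n * B * Jmat p) =
        Jmat p * (Bᵀ * T * B * -Jmat p) := by
      have h2 : T * (Jmat n * (B * Jmat p)) = Jmat n * (T * (B * Jmat p)) := by
        rw [← Matrix.mul_assoc, ← hJT, Matrix.mul_assoc]
      simp [Jmat_transpose, Matrix.mul_assoc, h2, hJJ]
    rw [h1, trace_mul_comm, Matrix.mul_assoc, Matrix.neg_mul, Jmat_mul_self]
    simp
  have hBTB : trace (Bᵀ * T * B) = trace (uᵀ * T * u) := by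
    have h1 : Bᵀ * T * B = v * (uᵀ * T * u * vᵀ) := by simp [hB, Matrix.mul_assoc]
    rw [h1, trace_mul_comm, Matrix.mul_assoc, hv, Matrix.mul_one]
  have hexp : trace (Uᵀ * T * U) = 2 * trace (uᵀ * T * u) := by
    rw [hU, transpose_sub, Matrix.sub_mul, Matrix.sub_mul, Matrix.mul_sub, Matrix.mul_sub,
      trace_sub, trace_sub, trace_sub, hcross, hcross', hJBJ, hBTB]
    ring
  linarith

end Variation

section Comparison

variable {m k : Type*} [Fintype m] [Fintype k] [DecidableEq k]

lemma sum_sq_sub_proj {Q R : Matrix m k ℝ} (hQ : Qᵀ * Q = 1) (hR : Rᵀ * R = 1) (j : k) :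
    ∑ i, (R - Q * (Qᵀ * R)) i j ^ 2 = 1 - ∑ l, (Qᵀ * R) l j ^ 2 := by
  have h1 : (R - Q * (Qᵀ * R))ᵀ * (R - Q * (Qᵀ * R)) = 1 - (Qᵀ * R)ᵀ * (Qᵀ * R) := by
    have h2 : Qᵀ * (Q * (Qᵀ * R)) = Qᵀ * R := by rw [← Matrix.mul_assoc, hQ, Matrix.one_mul]
    simp [Matrix.mul_sub, Matrix.sub_mul, Matrix.mul_assoc, h2, hR]
  have h3 := congrFun (congrFun h1 j) j
  rw [Matrix.sub_apply, one_apply_eq, mul_apply, mul_apply] at h3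
  simpa only [transpose_apply, ← sq] using h3

lemma sum_sq_transpose_mul_le {Q R : Matrix m k ℝ} (hQ : Qᵀ * Q = 1) (hR : Rᵀ * R = 1) (j : k) :
    ∑ l, (Qᵀ * R) l j ^ 2 ≤ 1 := by
  have h1 := sum_sq_sub_proj hQ hR j
  have h2 : 0 ≤ ∑ i, (R - Q * (Qᵀ * R)) i j ^ 2 := Finset.sum_nonneg fun _ _ => sq_nonneg _
  linarith

/-- Among orthonormal systems of eigenvectors of `1 - β⁻¹ Diag(δ)` with positive eigenvalues, one on
whose orthogonal complement the quadratic form is dominated by all of its eigenvalues has the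
largest sum of squared eigenvalues. -/
lemma sum_sq_le_of_curvature [DecidableEq m] {δ : m → ℝ} {β : ℝ} (hβ : 0 < β) {Q R : Matrix m k ℝ} {h g : k → ℝ}
    (hQ : Qᵀ * Q = 1) (hR : Rᵀ * R = 1) (hh : ∀ l, 0 < h l) (hg : ∀ l, 0 < g l)
    (hDQ : diagonal δ * Q = Q * diagonal (fun l => β * (1 - h l)))
    (hDR : diagonal δ * R = R * diagonal (fun l => β * (1 - g l)))
    (hcurv : ∀ u : m → ℝ, Qᵀ *ᵥ u = 0 → ∀ l, 0 ≤ ∑ i, (δ i + β * (h l - 1)) * u i ^ 2) :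
    ∑ l, g l ^ 2 ≤ ∑ l, h l ^ 2 := by
  rcases isEmpty_or_nonempty k with hk | hk
  · simp
  obtain ⟨l₀, hl₀⟩ := Finite.exists_min h
  obtain ⟨C, hC⟩ : ∃ C, C = Qᵀ * R := ⟨_, rfl⟩
  have hbal : ∀ l j, (h l - g j) * C l j = 0 := by
    intro l j
    have h1 : diagonal (fun l => β * (1 - h l)) * C = C * diagonal (fun l => β * (1 - g l)) := by
      have h2 := congrArg transpose hDQ
      simp only [transpose_mul, diagonal_transpose] at h2
      rw [hC, ← Matrix.mul_assoc, ← h2, Matrix.mul_assoc, hDR, Matrix.mul_assoc]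
    have h3 := congrFun (congrFun h1 l) j
    rw [diagonal_mul, mul_diagonal] at h3
    have h4 : β * ((h l - g j) * C l j) = 0 := by linarith
    exact (mul_eq_zero.1 h4).resolve_left hβ.ne'
  have hsq : ∀ l, 0 ≤ h l ^ 2 - h l₀ ^ 2 := fun l => by
    nlinarith [hl₀ l, hh l₀, hh l]
  have hkey : ∀ j, g j ^ 2 - h l₀ ^ 2 ≤ ∑ l, (h l ^ 2 - h l₀ ^ 2) * C l j ^ 2 := by
    intro j
    rcases le_or_gt (g j) (h l₀) with hle | hlt
    · have h1 : 0 ≤ ∑ l, (h l ^ 2 - h l₀ ^ 2) * C l j ^ 2 :=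
        Finset.sum_nonneg fun l _ => mul_nonneg (hsq l) (sq_nonneg _)
      nlinarith [hg j]
    · have hpyth := sum_sq_sub_proj hQ hR j
      rw [← hC] at hpyth
      set V := R - Q * C with hV
      have hQV : Qᵀ *ᵥ (fun i => V i j) = 0 := by
        have h1 : Qᵀ * V = 0 := by
          rw [hV, Matrix.mul_sub, ← Matrix.mul_assoc, hQ, Matrix.one_mul, hC, sub_self]
        ext l
        exact congrFun (congrFun h1 l) j
      have hDV : ∀ i, δ i * V i j = β * (1 - g j) * V i j := by
        intro i
        have h1 : diagonal δ * V = V * diagonal (fun l => β * (1 - g l)) := by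
          have h2 : diagonal (fun l => β * (1 - h l)) * C =
              C * diagonal (fun l => β * (1 - g l)) := by
            ext l j
            rw [diagonal_mul, mul_diagonal]
            linear_combination (-β) * hbal l j
          rw [hV, Matrix.mul_sub, Matrix.sub_mul, ← Matrix.mul_assoc, hDQ, hDR, Matrix.mul_assoc,
            h2, Matrix.mul_assoc]
        have h3 := congrFun (congrFun h1 i) j
        rw [diagonal_mul, mul_diagonal] at h3
        linarith
      have h1 := hcurv _ hQV l₀
      have h2 : ∑ i, (δ i + β * (h l₀ - 1)) * V i j ^ 2 =
          β * (h l₀ - g j) * ∑ i, V i j ^ 2 := by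
        rw [Finset.mul_sum]
        refine Finset.sum_congr rfl fun i _ => ?_
        linear_combination V i j * hDV i
      rw [h2] at h1
      have h3 : β * (h l₀ - g j) < 0 := mul_neg_of_pos_of_neg hβ (by linarith)
      have h4 : ∑ i, V i j ^ 2 ≤ 0 := by
        by_contra hcon
        push Not at hcon
        linarith [mul_neg_of_neg_of_pos h3 hcon]
      have h5 : ∑ l, (h l ^ 2 - h l₀ ^ 2) * C l j ^ 2 = (g j ^ 2 - h l₀ ^ 2) * ∑ l, C l j ^ 2 := by
        rw [Finset.mul_sum]
        refine Finset.sum_congr rfl fun l _ => ?_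
        linear_combination (h l + g j) * C l j * hbal l j
      rw [h5]
      have h6 : 0 < g j ^ 2 - h l₀ ^ 2 := by nlinarith [hh l₀]
      nlinarith
  have hrow : ∀ l, ∑ j, C l j ^ 2 ≤ 1 := by
    intro l
    have h1 := sum_sq_transpose_mul_le hR hQ l
    have h2 : ∀ j, (Rᵀ * Q) j l = C l j := fun j => by
      rw [← transpose_apply (Rᵀ * Q), transpose_mul, transpose_transpose, hC]
    simpa only [h2] using h1
  have hsum : ∑ j, (g j ^ 2 - h l₀ ^ 2) ≤ ∑ l, (h l ^ 2 - h l₀ ^ 2) := by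
    calc ∑ j, (g j ^ 2 - h l₀ ^ 2) ≤ ∑ j, ∑ l, (h l ^ 2 - h l₀ ^ 2) * C l j ^ 2 :=
          Finset.sum_le_sum fun j _ => hkey j
      _ = ∑ l, (h l ^ 2 - h l₀ ^ 2) * ∑ j, C l j ^ 2 := by
          rw [Finset.sum_comm]
          simp only [Finset.mul_sum]
      _ ≤ ∑ l, (h l ^ 2 - h l₀ ^ 2) :=
          Finset.sum_le_sum fun l _ => mul_le_of_le_one_right (hsq l) (hrow l)
  simp only [Finset.sum_sub_distrib] at hsum
  linarith

end Comparison

lemma exists_orthogonal_diagonalization {k : Type*} [Fintype k] [DecidableEq k]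
    {G : Matrix k k ℝ} (hG : Gᵀ = G) :
    ∃ (V : Matrix k k ℝ) (h : k → ℝ), Vᵀ * V = 1 ∧ V * Vᵀ = 1 ∧ G * V = V * diagonal h := by
  have hH : G.IsHermitian := by
    rw [Matrix.IsHermitian, conjTranspose_eq_transpose_of_trivial, hG]
  have h1 : (hH.eigenvectorUnitary : Matrix k k ℝ)ᵀ * hH.eigenvectorUnitary = 1 := by
    have := Unitary.coe_star_mul_self hH.eigenvectorUnitary
    rwa [star_eq_conjTranspose, conjTranspose_eq_transpose_of_trivial] at this
  refine ⟨hH.eigenvectorUnitary, hH.eigenvalues, h1, mul_eq_one_comm.1 h1, ?_⟩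
  ext i j
  have := congrFun (hH.mulVec_eigenvectorBasis j) i
  rw [mul_diagonal]
  simpa [mul_apply, mulVec, dotProduct, mul_comm] using this

section LocalMin

variable {n p : ℕ}

lemma mulVec_ne_zero_of_curvature (hpn : p ≤ n) {d : Fin n → ℝ} {β : ℝ}
    (hd : ∀ i : Fin p, d (Fin.castLE hpn i) < β)
    {Z : Matrix (Fin n ⊕ Fin n) (Fin p ⊕ Fin p) ℝ}
    (hcurv : ∀ u : Fin n ⊕ Fin n → ℝ, Zᵀ *ᵥ u = 0 →
      0 ≤ ∑ i, (Sum.elim d d i - β) * u i ^ 2)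
    {v : Fin p ⊕ Fin p → ℝ} (hv : v ≠ 0) : Z *ᵥ v ≠ 0 := by
  intro hZv
  set ι : Fin p ⊕ Fin p → Fin n ⊕ Fin n := Sum.map (Fin.castLE hpn) (Fin.castLE hpn) with hι
  have hinj : Function.Injective ι :=
    Function.Injective.sumMap (Fin.castLE_injective hpn) (Fin.castLE_injective hpn)
  have hδ : ∀ k, Sum.elim d d (ι k) < β := by rintro (k | k) <;> exact hd k
  have hdet : (Z.submatrix ι id).det = 0 := by
    refine exists_mulVec_eq_zero_iff.1 ⟨v, hv, ?_⟩
    ext k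
    exact congrFun hZv (ι k)
  obtain ⟨w, hw0, hw⟩ := exists_vecMul_eq_zero_iff.2 hdet
  set u : Fin n ⊕ Fin n → ℝ := Function.extend ι w 0 with hu
  have hu1 : ∀ k, u (ι k) = w k := fun k => hinj.extend_apply w _ k
  have hu0 : ∀ i, i ∉ Set.range ι → u i = 0 := fun i hi =>
    Function.extend_apply' w (0 : Fin n ⊕ Fin n → ℝ) i hi
  have hZu : Zᵀ *ᵥ u = 0 := by
    rw [mulVec_transpose, ← hw]
    ext j
    simp only [vecMul, dotProduct]
    refine (Fintype.sum_of_injective ι hinj _ _ (fun i hi => ?_) (fun k => ?_)).symm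
    · rw [hu0 i hi, zero_mul]
    · rw [hu1]; rfl
  have hsum : ∑ k, (Sum.elim d d (ι k) - β) * w k ^ 2 = ∑ i, (Sum.elim d d i - β) * u i ^ 2 := by
    refine Fintype.sum_of_injective ι hinj _ _ (fun i hi => ?_) (fun k => ?_)
    · rw [hu0 i hi]; ring
    · rw [hu1]
  have hneg : ∑ k, (Sum.elim d d (ι k) - β) * w k ^ 2 < 0 := by
    obtain ⟨k, hk⟩ := Function.ne_iff.1 hw0
    refine Finset.sum_neg' (fun k _ => ?_) ⟨k, Finset.mem_univ k, ?_⟩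
    · exact mul_nonpos_of_nonpos_of_nonneg (by linarith [hδ k]) (sq_nonneg _)
    · have hk' : w k ≠ 0 := hk
      exact mul_neg_of_neg_of_pos (by linarith [hδ k]) (by positivity)
  linarith [hcurv u hZu]

lemma exists_eigensystem_of_isLocalMin (hpn : p ≤ n) {d : Fin n → ℝ} (hdpos : ∀ i, 0 < d i)
    {β : ℝ} (hβ : 0 < β) (hd : ∀ i : Fin p, d (Fin.castLE hpn i) < β)
    {Z : Matrix (Fin n ⊕ Fin n) (Fin p ⊕ Fin p) ℝ}
    (hZ : IsLocalMin (fPen n p (diagonal (Sum.elim d d)) β) Z) :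
    ∃ (Q : Matrix (Fin n ⊕ Fin n) (Fin p ⊕ Fin p) ℝ) (h : Fin p ⊕ Fin p → ℝ),
      Qᵀ * Q = 1 ∧ (∀ l, 0 < h l) ∧
      diagonal (Sum.elim d d) * Q = Q * diagonal (fun l => β * (1 - h l)) ∧
      (∀ u : Fin n ⊕ Fin n → ℝ, Qᵀ *ᵥ u = 0 →
        ∀ l, 0 ≤ ∑ i, (Sum.elim d d i + β * (h l - 1)) * u i ^ 2) ∧
      fPen n p (diagonal (Sum.elim d d)) β Z = β / 4 * ∑ l, (1 - h l ^ 2) := by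
  have hJ := Jmat_mul_comm_of_isLocalMin hdpos hβ hZ
  have hDZ := mul_eq_of_isLocalMin hZ hJ
  have hf := fPen_eq_of_isLocalMin hZ hJ
  obtain ⟨V, h, hVV, hVV', hGV⟩ :=
    exists_orthogonal_diagonalization (G := Zᵀ * Z) (by simp)
  have hcurv : ∀ u : Fin n ⊕ Fin n → ℝ, Zᵀ *ᵥ u = 0 →
      ∀ l, 0 ≤ ∑ i, (Sum.elim d d i + β * (h l - 1)) * u i ^ 2 := by
    intro u hu l
    have hv : (replicateCol Unit (V.col l))ᵀ * replicateCol Unit (V.col l) = 1 := by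
      ext a b
      have := congrFun (congrFun hVV l) l
      rw [one_apply_eq] at this
      rw [Subsingleton.elim a b, one_apply_eq, ← this]
      rfl
    have hGv : Zᵀ * Z * replicateCol Unit (V.col l) = h l • replicateCol Unit (V.col l) := by
      ext i a
      have := congrFun (congrFun hGV i) l
      rw [mul_diagonal, mul_comm] at this
      exact this
    have hu' : Zᵀ * replicateCol Unit u = 0 := by
      ext i a
      exact congrFun hu i
    have h1 := curvature_of_isLocalMin hZ hJ hv hGv hu'
    have h2 : diagonal (Sum.elim d d) +
        (β * (h l - 1)) • (1 : Matrix (Fin n ⊕ Fin n) (Fin n ⊕ Fin n) ℝ) =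
        diagonal (fun i => Sum.elim d d i + β * (h l - 1)) := by
      rw [smul_one_eq_diagonal, diagonal_add]
    rw [h2, trace_transpose_mul_diagonal_mul] at h1
    simpa using h1
  have hgram : (Z * V)ᵀ * (Z * V) = diagonal h := by
    rw [transpose_mul, Matrix.mul_assoc, ← Matrix.mul_assoc Zᵀ, hGV, ← Matrix.mul_assoc, hVV,
      Matrix.one_mul]
  have hsq : ∀ l, ∑ i, (Z * V) i l ^ 2 = h l := by
    intro l
    have := congrFun (congrFun hgram l) l
    rw [diagonal_apply_eq, mul_apply] at this
    simpa only [transpose_apply, ← sq] using this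
  have hpos : ∀ l, 0 < h l := by
    intro l
    have h0 : 0 ≤ h l := by
      rw [← hsq l]
      exact Finset.sum_nonneg fun _ _ => sq_nonneg _
    refine lt_of_le_of_ne h0 fun hl => ?_
    have hVl : V.col l ≠ 0 := by
      intro hV0
      have h1 := congrFun (congrFun hVV l) l
      rw [one_apply_eq, mul_apply] at h1
      have h2 : ∀ i, V i l = 0 := fun i => congrFun hV0 i
      simp [h2] at h1
    refine mulVec_ne_zero_of_curvature hpn hd (Z := Z) (fun u hu => ?_) hVl ?_
    · have h1 := hcurv u hu l
      rw [← hl] at h1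
      convert h1 using 3
      ring
    · have h1 := hsq l
      rw [← hl, Finset.sum_eq_zero_iff_of_nonneg (fun _ _ => sq_nonneg _)] at h1
      ext i
      exact pow_eq_zero_iff (two_ne_zero) |>.1 (h1 i (Finset.mem_univ i))
  set S : Matrix (Fin p ⊕ Fin p) (Fin p ⊕ Fin p) ℝ := diagonal (fun l => (√(h l))⁻¹) with hS
  have hST : Sᵀ = S := diagonal_transpose _
  have hsqrt : ∀ l, √(h l) ≠ 0 := fun l => (Real.sqrt_pos.2 (hpos l)).ne'
  refine ⟨Z * V * S, h, ?_, hpos, ?_, ?_, ?_⟩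
  · rw [transpose_mul, hST, Matrix.mul_assoc, ← Matrix.mul_assoc (Z * V)ᵀ, hgram, hS,
      diagonal_mul_diagonal, diagonal_mul_diagonal, ← diagonal_one]
    congr 1
    funext l
    have := Real.mul_self_sqrt (hpos l).le
    have := hsqrt l
    field_simp
    nlinarith
  · have h1 : (1 - Zᵀ * Z) * V = V * diagonal (fun l => 1 - h l) := by
      have h2 : diagonal (fun l => 1 - h l) = 1 - diagonal h := by
        rw [← diagonal_one, diagonal_sub]
      rw [h2, Matrix.sub_mul, Matrix.mul_sub, hGV, Matrix.one_mul, Matrix.mul_one]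
    have h3 : diagonal (fun l => β * (1 - h l)) = β • diagonal (fun l => 1 - h l) := by
      rw [← diagonal_smul]; rfl
    have h4 : S * diagonal (fun l => 1 - h l) = diagonal (fun l => 1 - h l) * S := by
      rw [hS, diagonal_mul_diagonal, diagonal_mul_diagonal]
      simp only [mul_comm]
    have h5 : Z * V * S * diagonal (fun l => 1 - h l) = Z * ((1 - Zᵀ * Z) * V) * S := by
      rw [h1, Matrix.mul_assoc _ S, h4]
      simp only [Matrix.mul_assoc]
    rw [h3, Matrix.mul_smul, h5, ← Matrix.mul_assoc, ← Matrix.mul_assoc, hDZ]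
    simp only [Matrix.mul_assoc, smul_mul]
  · intro u hu l
    refine hcurv u ?_ l
    have h1 : Zᵀ = V * (diagonal (fun l => √(h l)) * (Z * V * S)ᵀ) := by
      rw [transpose_mul, hST, ← Matrix.mul_assoc (diagonal _), hS, diagonal_mul_diagonal]
      simp only [mul_inv_cancel₀ (hsqrt _), diagonal_one]
      rw [Matrix.one_mul, transpose_mul, ← Matrix.mul_assoc, hVV', Matrix.one_mul]
    rw [h1, ← mulVec_mulVec, ← mulVec_mulVec, hu, mulVec_zero, mulVec_zero]
  · have h1 : Zᵀ * Z = V * diagonal h * Vᵀ := by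
      rw [← hGV, Matrix.mul_assoc _ V, hVV', Matrix.mul_one]
    have h2 : trace (Zᵀ * Z * (Zᵀ * Z)) = ∑ l, h l ^ 2 := by
      have h3 : Zᵀ * Z * (Zᵀ * Z) = V * (diagonal h * diagonal h * Vᵀ) := by
        rw [h1, Matrix.mul_assoc _ Vᵀ, ← Matrix.mul_assoc Vᵀ, ← Matrix.mul_assoc Vᵀ, hVV]
        simp only [Matrix.mul_assoc, Matrix.one_mul]
      rw [h3, trace_mul_comm, Matrix.mul_assoc, hVV, Matrix.mul_one, diagonal_mul_diagonal,
        trace_diagonal]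
      simp only [sq]
    rw [hf, trace_sub, h2, trace_one, Finset.sum_sub_distrib]
    simp

lemma fPen_le_of_isLocalMin (hpn : p ≤ n) {d : Fin n → ℝ} (hdpos : ∀ i, 0 < d i)
    {β : ℝ} (hβ : 0 < β) (hd : ∀ i : Fin p, d (Fin.castLE hpn i) < β)
    {Y Z : Matrix (Fin n ⊕ Fin n) (Fin p ⊕ Fin p) ℝ}
    (hY : IsLocalMin (fPen n p (diagonal (Sum.elim d d)) β) Y)
    (hZ : IsLocalMin (fPen n p (diagonal (Sum.elim d d)) β) Z) :
    fPen n p (diagonal (Sum.elim d d)) β Z ≤ fPen n p (diagonal (Sum.elim d d)) β Y := by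
  obtain ⟨Q, h, hQ, hh, hDQ, hcurv, hfZ⟩ := exists_eigensystem_of_isLocalMin hpn hdpos hβ hd hZ
  obtain ⟨R, g, hR, hg, hDR, -, hfY⟩ := exists_eigensystem_of_isLocalMin hpn hdpos hβ hd hY
  rw [hfZ, hfY]
  have := sum_sq_le_of_curvature hβ hQ hR hh hg hDQ hDR hcurv
  refine mul_le_mul_of_nonneg_left ?_ (by positivity)
  simp only [Finset.sum_sub_distrib]
  linarith

lemma continuous_fPen (A : Matrix (Fin n ⊕ Fin n) (Fin n ⊕ Fin n) ℝ) (β : ℝ) :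
    Continuous (fPen n p A β) := by
  unfold fPen frobSq
  fun_prop

lemma exists_forall_fPen_le {d : Fin n → ℝ} (hdpos : ∀ i, 0 < d i) {β : ℝ} (hβ : 0 < β) :
    ∃ Y : Matrix (Fin n ⊕ Fin n) (Fin p ⊕ Fin p) ℝ,
      ∀ Z, fPen n p (diagonal (Sum.elim d d)) β Y ≤ fPen n p (diagonal (Sum.elim d d)) β Z := by
  set f : Matrix (Fin n ⊕ Fin n) (Fin p ⊕ Fin p) ℝ → ℝ :=
    fPen n p (diagonal (Sum.elim d d)) β with hf
  have hδ : ∀ i, 0 < Sum.elim d d i := by rintro (i | i) <;> exact hdpos i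
  have hbound : ∀ Z i j, Sum.elim d d i * Z i j ^ 2 ≤ 2 * f Z := by
    intro Z i j
    have h1 : f Z = 1 / 2 * trace (Zᵀ * diagonal (Sum.elim d d) * Z) +
      β / 4 * frobSq (sympResidual Z) := rfl
    have h2 := mul_nonneg (by positivity : 0 ≤ β / 4) (frobSq_nonneg (sympResidual Z))
    rw [trace_transpose_mul_diagonal_mul] at h1
    have hterm : ∀ i j, 0 ≤ Sum.elim d d i * Z i j ^ 2 := fun i j =>
      mul_nonneg (hδ i).le (sq_nonneg _)
    have h3 := Finset.single_le_sum (f := fun i => Sum.elim d d i * Z i j ^ 2)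
      (fun i _ => hterm i j) (Finset.mem_univ i)
    have h4 := Finset.single_le_sum (f := fun j => ∑ i, Sum.elim d d i * Z i j ^ 2)
      (fun j _ => Finset.sum_nonneg fun i _ => hterm i j) (Finset.mem_univ j)
    linarith
  set K : Set (Matrix (Fin n ⊕ Fin n) (Fin p ⊕ Fin p) ℝ) :=
    Set.univ.pi fun i => Set.univ.pi fun _ =>
      Set.Icc (-√(2 * f 0 / Sum.elim d d i)) (√(2 * f 0 / Sum.elim d d i)) with hK
  have hKc : IsCompact K :=
    isCompact_univ_pi fun i => isCompact_univ_pi fun _ => isCompact_Icc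
  have hmem : ∀ Z, f Z ≤ f 0 → Z ∈ K := by
    intro Z hZ i _ j _
    rw [Set.mem_Icc, ← abs_le]
    refine Real.abs_le_sqrt ?_
    rw [le_div_iff₀ (hδ i)]
    linarith [hbound Z i j]
  obtain ⟨Y, -, hY⟩ := hKc.exists_isMinOn ⟨0, hmem 0 le_rfl⟩
    (continuous_fPen (diagonal (Sum.elim d d)) β).continuousOn
  refine ⟨Y, fun Z => ?_⟩
  rcases le_total (f Z) (f 0) with h | h
  · exact hY (hmem Z h)
  · exact (hY (hmem 0 le_rfl)).trans h

lemma fPen_mul_left {A S : Matrix (Fin n ⊕ Fin n) (Fin n ⊕ Fin n) ℝ}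
    (hS : Sᵀ * Jmat n * S = Jmat n) (β : ℝ) (Z : Matrix (Fin n ⊕ Fin n) (Fin p ⊕ Fin p) ℝ) :
    fPen n p A β (S * Z) = fPen n p (Sᵀ * A * S) β Z := by
  have h1 : ∀ B, (S * Z)ᵀ * B * (S * Z) = Zᵀ * (Sᵀ * B * S) * Z := by
    intro B
    simp only [transpose_mul, Matrix.mul_assoc]
  rw [fPen, fPen, h1, h1, hS]

lemma mul_right_inv_of_symplectic {S : Matrix (Fin n ⊕ Fin n) (Fin n ⊕ Fin n) ℝ}
    (hS : Sᵀ * Jmat n * S = Jmat n) : S * (-(Jmat n * (Sᵀ * Jmat n))) = 1 := by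
  refine mul_eq_one_comm.1 ?_
  rw [Matrix.neg_mul, Matrix.mul_assoc, hS, Jmat_mul_self, neg_neg]

end LocalMin

theorem stmt6 (n p : ℕ) (hp : 1 ≤ p) (hpn : p ≤ n)
    (A : Matrix (Fin n ⊕ Fin n) (Fin n ⊕ Fin n) ℝ) (hA : A.PosDef)
    (d : Fin n → ℝ) (hmono : Monotone d) (hdpos : ∀ i, 0 < d i)
    (S₀ : Matrix (Fin n ⊕ Fin n) (Fin n ⊕ Fin n) ℝ)
    (hS₀symp : S₀ᵀ * Jmat n * S₀ = Jmat n)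
    (hS₀diag : S₀ᵀ * A * S₀ = Matrix.diagonal (Sum.elim d d))
    (β : ℝ) (hβ : d ⟨p - 1, by omega⟩ < β)
    (X : Matrix (Fin n ⊕ Fin n) (Fin p ⊕ Fin p) ℝ)
    (hloc : IsLocalMin (fPen n p A β) X) :
    ∀ Y, fPen n p A β X ≤ fPen n p A β Y := by
  have hd : ∀ i : Fin p, d (Fin.castLE hpn i) < β := fun i =>
    (hmono (Fin.mk_le_mk.2 (Nat.le_sub_one_of_lt i.2))).trans_lt hβ
  have hβ0 : 0 < β := (hdpos _).trans hβ
  set T := -(Jmat n * (S₀ᵀ * Jmat n)) with hT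
  have hST : S₀ * T = 1 := mul_right_inv_of_symplectic hS₀symp
  have hcancel : ∀ Y : Matrix (Fin n ⊕ Fin n) (Fin p ⊕ Fin p) ℝ, S₀ * (T * Y) = Y := fun Y => by
    rw [← Matrix.mul_assoc, hST, Matrix.one_mul]
  have hf : ∀ Z, fPen n p A β (S₀ * Z) = fPen n p (diagonal (Sum.elim d d)) β Z := fun Z => by
    rw [fPen_mul_left hS₀symp, hS₀diag]
  have hloc' : IsLocalMin (fPen n p (diagonal (Sum.elim d d)) β) (T * X) := by
    have h1 : IsLocalMin (fPen n p A β) (S₀ * (T * X)) := by rwa [hcancel]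
    have h2 : ContinuousAt (fun Z : Matrix (Fin n ⊕ Fin n) (Fin p ⊕ Fin p) ℝ => S₀ * Z)
        (T * X) := by fun_prop
    have h3 := h1.comp_continuous (g := fun Z => S₀ * Z) h2
    rwa [show fPen n p A β ∘ (fun Z => S₀ * Z) = fPen n p (diagonal (Sum.elim d d)) β from
      funext hf] at h3
  obtain ⟨Y₀, hY₀⟩ := exists_forall_fPen_le (p := p) hdpos hβ0
  have hle := fPen_le_of_isLocalMin hpn hdpos hβ0 hd (Filter.Eventually.of_forall hY₀) hloc'
  intro Y
  rw [← hcancel X, ← hcancel Y, hf, hf]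
  exact hle.trans (hY₀ _)
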